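/- Assume $2\beta \notin \mathbb{Z}$ (so $\{\beta+s+t\} \neq 0$ for all integers $s,t$). Then $\sum_{s=0}^{\ell-1}\sum_{t=0}^{\ell-1} \dfrac{\xi^{-(\beta+s+t)}\,\xi^{2(t^2+st)}}{\{\beta+s+t\}} = -\ell + \dfrac{\ell\,\xi^{\beta}}{\{\beta\}}$. -/

import Mathlib

open Complex

/-- `ξ^x = exp(2πix/ℓ)`. -/
noncomputable def xi (ℓ : ℕ) (x : ℂ) : ℂ := Complex.exp (2 * (Real.pi : ℂ) * Complex.I * x / (ℓ : ℂ))

/-- `{x} = ξ^x - ξ^{-x}`. -/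
noncomputable def br (ℓ : ℕ) (x : ℂ) : ℂ := xi ℓ x - xi ℓ (-x)

theorem xi_add (ℓ : ℕ) (x y : ℂ) : xi ℓ (x + y) = xi ℓ x * xi ℓ y := by
  rw [xi, xi, xi, ← Complex.exp_add]
  congr 1
  ring

theorem xi_natCast (ℓ n : ℕ) : xi ℓ (n : ℂ) = xi ℓ 1 ^ n := by
  rw [xi, xi, ← Complex.exp_nat_mul]
  congr 1
  ring

theorem xi_mul_xi_neg (ℓ : ℕ) (x : ℂ) : xi ℓ x * xi ℓ (-x) = 1 := by
  rw [← xi_add]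
  simp [xi]

theorem isPrimitiveRoot_xi_one {ℓ : ℕ} (h : ℓ ≠ 0) : IsPrimitiveRoot (xi ℓ 1) ℓ := by
  simpa [xi] using Complex.isPrimitiveRoot_exp ℓ h

theorem xi_neg_div_br (ℓ : ℕ) (x : ℂ) : xi ℓ (-x) / br ℓ x = 1 / (xi ℓ (2 * x) - 1) := by
  have hx : xi ℓ x ≠ 0 := Complex.exp_ne_zero _
  rw [← mul_div_mul_left _ _ hx, xi_mul_xi_neg, br, mul_sub, xi_mul_xi_neg, ← xi_add, two_mul]

theorem br_ne_zero {ℓ : ℕ} (h : ℓ ≠ 0) {x : ℂ} (hx : ∀ m : ℤ, 2 * x ≠ (m : ℂ)) :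
    br ℓ x ≠ 0 := by
  intro h0
  obtain ⟨n, hn⟩ := Complex.exp_eq_exp_iff_exists_int.mp (sub_eq_zero.mp h0)
  have hℓ : (ℓ : ℂ) ≠ 0 := Nat.cast_ne_zero.mpr h
  apply hx (n * ℓ)
  push_cast
  field_simp at hn
  refine mul_left_cancel₀ Complex.two_pi_I_ne_zero ?_
  linear_combination (2 * (Real.pi : ℂ) * Complex.I) * hn

/-- A sum over a full period does not change under translation. -/
theorem Function.Periodic.sum_range_add {M : Type*} [AddCommMonoid M] {f : ℕ → M} {n : ℕ}
    (hf : Function.Periodic f n) (t : ℕ) :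
    ∑ s ∈ Finset.range n, f (s + t) = ∑ s ∈ Finset.range n, f s := by
  induction t with
  | zero => rfl
  | succ t ih =>
    rw [← ih]
    cases n with
    | zero => rfl
    | succ n =>
      rw [Finset.sum_range_succ, Finset.sum_range_succ' (fun s => f (s + t))]
      congr 1
      · exact Finset.sum_congr rfl fun s _ => congrArg f (by ring)
      · rw [← hf (0 + t)]
        exact congrArg f (by ring)

theorem IsPrimitiveRoot.sum_pow_mul_eq_zero {R : Type*} [CommRing R] [IsDomain R] {z : R} {n u : ℕ}
    (hz : IsPrimitiveRoot z n) (hu : ¬ n ∣ u) :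
    ∑ t ∈ Finset.range n, z ^ (u * t) = 0 := by
  have h1 : z ^ u - 1 ≠ 0 := fun h => hu (hz.dvd_of_pow_eq_one u (sub_eq_zero.mp h))
  simp_rw [pow_mul]
  apply mul_left_cancel₀ h1
  rw [mul_geom_sum, ← pow_mul, mul_comm u n, pow_mul, hz.pow_eq_one]
  simp

/-- `∑_{s,t=0}^{ℓ-1} ξ^{-(β+s+t)} ξ^{2(t²+st)} / {β+s+t} = -ℓ + ℓ ξ^{β}/{β}`. -/
theorem gauss_sum_second
    (ℓ : ℕ) (hℓ3 : 3 ≤ ℓ) (hodd : Odd ℓ)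
    (β : ℂ)
    (hβ : ∀ m : ℤ, 2 * β ≠ (m : ℂ)) :
    ∑ s ∈ Finset.range ℓ, ∑ t ∈ Finset.range ℓ,
        xi ℓ (-(β + (s : ℂ) + (t : ℂ))) * xi ℓ (2 * ((t : ℂ) ^ 2 + (s : ℂ) * (t : ℂ)))
          / br ℓ (β + (s : ℂ) + (t : ℂ))
      = -(ℓ : ℂ) + (ℓ : ℂ) * xi ℓ β / br ℓ β := by
  have hℓ : ℓ ≠ 0 := by omega
  have hz : IsPrimitiveRoot (xi ℓ 1 ^ 2) ℓ :=
    (isPrimitiveRoot_xi_one hℓ).pow_of_coprime 2 (Nat.coprime_two_left.mpr hodd)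
  set z := xi ℓ 1 ^ 2
  let f : ℕ → ℕ → ℂ := fun t u => z ^ (u * t) * (1 / (xi ℓ (2 * β) * z ^ u - 1))
  have hf (t : ℕ) : Function.Periodic (f t) ℓ := fun u => by
    simp only [f, pow_add, pow_mul, hz.pow_eq_one, mul_one]
  have hterm (s t : ℕ) :
      xi ℓ (-(β + (s : ℂ) + (t : ℂ))) * xi ℓ (2 * ((t : ℂ) ^ 2 + (s : ℂ) * (t : ℂ)))
        / br ℓ (β + (s : ℂ) + (t : ℂ)) = f t (s + t) := by
    have h1 : 2 * ((t : ℂ) ^ 2 + (s : ℂ) * (t : ℂ)) = ((2 * ((s + t) * t) : ℕ) : ℂ) := by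
      push_cast
      ring
    have h2 : 2 * (β + (s : ℂ) + (t : ℂ)) = 2 * β + ((2 * (s + t) : ℕ) : ℂ) := by
      push_cast
      ring
    rw [mul_div_right_comm, xi_neg_div_br, h1, h2, xi_add, xi_natCast, xi_natCast, pow_mul,
      pow_mul, mul_comm]
  simp_rw [hterm]
  rw [Finset.sum_comm]
  simp_rw [fun t => (hf t).sum_range_add t]
  rw [Finset.sum_comm, Finset.sum_eq_single_of_mem 0 (Finset.mem_range.mpr (by omega))]
  · have hb := br_ne_zero hℓ hβ
    simp only [f, zero_mul, pow_zero, mul_one, one_mul, ← xi_neg_div_br, Finset.sum_const,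
      Finset.card_range, nsmul_eq_mul]
    field_simp
    rw [br]
    ring
  · intro u hu hu0
    have hdvd : ¬ ℓ ∣ u :=
      Nat.not_dvd_of_pos_of_lt (Nat.pos_of_ne_zero hu0) (Finset.mem_range.mp hu)
    rw [← Finset.sum_mul, hz.sum_pow_mul_eq_zero hdvd, zero_mul]
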